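/- arXiv:1604.08439 — 7 statements merged into one kernel-verified Lean document; each statement's English description precedes it below -/
import Mathlib

section
/- Let C_n denote the number of connected labelled graphs on n vertices, i.e. the number of subsets S of the edge set of the complete graph K_n (on Fin n) such that the spanning subgraph with edge set S is connected. Then for every n ≥ 7, C_n ≥ 2^{n(n−1)/2} · (1 − 3n·2^{−n}); equivalently, 2^n · C_n ≥ 2^{n(n−1)/2} · (2^n − 3n). -/
/-- `C n` is the number of connected labelled graphs on `n` vertices, i.e. the number of edge
subsets `S` of the complete graph on `Fin n` whose spanning subgraph is connected. -/
noncomputable def connectedLabelledGraphCount (n : ℕ) : ℕ :=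
  Nat.card {S : Finset (Sym2 (Fin n)) //
    (S : Set (Sym2 (Fin n))) ⊆ (⊤ : SimpleGraph (Fin n)).edgeSet ∧
    (SimpleGraph.fromEdgeSet (S : Set (Sym2 (Fin n)))).Connected}

/-- The edges of the complete graph joining a vertex of `B` to a vertex outside `B`. -/
def cutEdges {V : Type*} [Fintype V] [DecidableEq V] (B : Finset V) : Finset (Sym2 V) :=
  (B ×ˢ Bᶜ).image fun p => s(p.1, p.2)

theorem card_cutEdges {V : Type*} [Fintype V] [DecidableEq V] (B : Finset V) :
    (cutEdges B).card = B.card * (Fintype.card V - B.card) := by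
  rw [cutEdges, Finset.card_image_of_injOn, Finset.card_product, Finset.card_compl]
  rintro ⟨a, b⟩ hab ⟨c, d⟩ hcd h
  simp only [Finset.coe_product, Set.mem_prod, Finset.mem_coe, Finset.mem_compl] at hab hcd
  simp only [Sym2.eq_iff] at h
  grind

theorem cutEdges_subset_edgeFinset_top {V : Type*} [Fintype V] [DecidableEq V] (B : Finset V) :
    cutEdges B ⊆ (⊤ : SimpleGraph V).edgeFinset := by
  intro e he
  simp only [cutEdges, Finset.mem_image, Finset.mem_product, Finset.mem_compl] at he
  obtain ⟨⟨a, b⟩, ⟨ha, hb⟩, rfl⟩ := he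
  simp only [SimpleGraph.mem_edgeFinset, SimpleGraph.mem_edgeSet, SimpleGraph.top_adj]
  grind

theorem exists_disjoint_cutEdges_of_not_connected {V : Type*} [Fintype V] [DecidableEq V] (v : V)
    (S : Finset (Sym2 V)) (hS : ¬ (SimpleGraph.fromEdgeSet (S : Set (Sym2 V))).Connected) :
    ∃ B : Finset V, B.Nonempty ∧ v ∉ B ∧ Disjoint S (cutEdges B) := by
  classical
  set G := SimpleGraph.fromEdgeSet (S : Set (Sym2 V)) with hG
  refine ⟨Finset.univ.filter fun w => ¬ G.Reachable v w, ?_, by simp, ?_⟩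
  · by_contra h
    refine hS (SimpleGraph.connected_iff_exists_forall_reachable _ |>.2 ⟨v, fun w => ?_⟩)
    by_contra hw
    exact h ⟨w, by simpa using hw⟩
  · rw [Finset.disjoint_right]
    intro e he heS
    simp only [cutEdges, Finset.mem_image, Finset.mem_product, Finset.mem_compl,
      Finset.mem_filter, Finset.mem_univ, true_and, not_not] at he
    obtain ⟨⟨a, b⟩, ⟨ha, hb⟩, rfl⟩ := he
    refine ha (hb.trans (SimpleGraph.Adj.reachable ?_))
    rw [hG, SimpleGraph.fromEdgeSet_adj]
    refine ⟨by simpa [Sym2.eq_swap] using heS, ?_⟩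
    exact fun h => ha (h ▸ hb)

/-- Every disconnected graph on `m + 1` vertices misses all edges of a cut given by a nonempty
set of vertices that avoids a fixed vertex. -/
theorem two_pow_le_connectedLabelledGraphCount_add (m : ℕ) :
    2 ^ (m + 1).choose 2 ≤ connectedLabelledGraphCount (m + 1) +
      ∑ k ∈ Finset.range m,
        m.choose (k + 1) * 2 ^ ((m + 1).choose 2 - (k + 1) * (m + 1 - (k + 1))) := by
  classical
  set E := (⊤ : SimpleGraph (Fin (m + 1))).edgeFinset with hE
  have hEcard : E.card = (m + 1).choose 2 := by
    rw [hE, SimpleGraph.card_edgeFinset_top_eq_card_choose_two, Fintype.card_fin]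
  set conn : Finset (Sym2 (Fin (m + 1))) → Prop :=
    fun S => (SimpleGraph.fromEdgeSet (S : Set (Sym2 (Fin (m + 1))))).Connected
  have hC : connectedLabelledGraphCount (m + 1) = (E.powerset.filter conn).card := by
    refine Nat.subtype_card _ fun S => ?_
    rw [Finset.mem_filter, Finset.mem_powerset, hE, ← Finset.coe_subset,
      SimpleGraph.coe_edgeFinset]
  set U : Finset (Fin (m + 1)) := Finset.univ.erase 0
  have hU : U.card = m := by simp [U]
  have hD : (E.powerset.filter fun S => ¬ conn S) ⊆
      (U.powerset.erase ∅).biUnion fun B => (E \ cutEdges B).powerset := by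
    intro S hS
    simp only [Finset.mem_filter, Finset.mem_powerset] at hS
    obtain ⟨B, hB, h0, hSB⟩ := exists_disjoint_cutEdges_of_not_connected 0 S hS.2
    simp only [Finset.mem_biUnion, Finset.mem_erase, Finset.mem_powerset]
    refine ⟨B, ⟨hB.ne_empty, ?_⟩, Finset.subset_sdiff.2 ⟨hS.1, hSB⟩⟩
    intro w hw
    simp only [U, Finset.mem_erase, Finset.mem_univ, and_true]
    rintro rfl
    exact h0 hw
  have hf (B : Finset (Fin (m + 1))) : (E \ cutEdges B).powerset.card =
      2 ^ ((m + 1).choose 2 - B.card * (m + 1 - B.card)) := by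
    rw [Finset.card_powerset, Finset.card_sdiff_of_subset (cutEdges_subset_edgeFinset_top B),
      card_cutEdges, hEcard, Fintype.card_fin]
  have hsum : ∑ B ∈ U.powerset.erase ∅, (E \ cutEdges B).powerset.card =
      ∑ k ∈ Finset.range m,
        m.choose (k + 1) * 2 ^ ((m + 1).choose 2 - (k + 1) * (m + 1 - (k + 1))) := by
    have h1 := Finset.add_sum_erase U.powerset (fun B => (E \ cutEdges B).powerset.card)
      (Finset.empty_mem_powerset U)
    have h2 := Finset.sum_powerset_apply_card
      (fun k => 2 ^ ((m + 1).choose 2 - k * (m + 1 - k))) (x := U)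
    simp only [hf] at h1 ⊢
    rw [h2, hU, Finset.sum_range_succ'] at h1
    simp only [smul_eq_mul, Finset.card_empty, Nat.choose_zero_right, one_mul] at h1
    omega
  calc 2 ^ (m + 1).choose 2 = E.powerset.card := by rw [Finset.card_powerset, hEcard]
    _ = (E.powerset.filter conn).card + (E.powerset.filter fun S => ¬ conn S).card :=
        (Finset.card_filter_add_card_filter_not _).symm
    _ ≤ _ := by
        rw [hC, ← hsum]
        exact Nat.add_le_add_left ((Finset.card_le_card hD).trans Finset.card_biUnion_le) _

/-- The terms of cut size `1` and `m` contribute `(m + 1) * 2 ^ (N - m)`, all others have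
exponent at most `N - 2 * (m - 1)`. -/
theorem sum_choose_mul_two_pow_le (m N : ℕ) (hm : 6 ≤ m) (hN : 2 * (m - 1) ≤ N) :
    2 ^ (m + 1) * ∑ k ∈ Finset.range m,
        m.choose (k + 1) * 2 ^ (N - (k + 1) * (m + 1 - (k + 1))) ≤ 3 * (m + 1) * 2 ^ N := by
  obtain ⟨j, rfl⟩ : ∃ j, m = j + 2 := ⟨m - 2, by omega⟩
  obtain ⟨M, rfl⟩ : ∃ M, N = M + 2 * (j + 1) := ⟨N - 2 * (j + 1), by omega⟩
  have hmid : ∑ k ∈ Finset.range j, (j + 2).choose (k + 2) *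
      2 ^ (M + 2 * (j + 1) - (k + 2) * (j + 3 - (k + 2))) ≤
      ∑ k ∈ Finset.range j, (j + 2).choose (k + 2) * 2 ^ M := by
    refine Finset.sum_le_sum fun k hk => ?_
    gcongr
    · norm_num
    · obtain ⟨i, rfl⟩ : ∃ i, j = k + 1 + i :=
        ⟨j - (k + 1), by have := Finset.mem_range.1 hk; omega⟩
      have : k + 1 + i + 3 - (k + 2) = i + 2 := by omega
      rw [this, Nat.sub_le_iff_le_add]
      nlinarith [Nat.zero_le (k * i)]
  have hchoose : ∑ k ∈ Finset.range j, (j + 2).choose (k + 2) + (j + 4) = 2 ^ (j + 2) := by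
    have h := Nat.sum_range_choose (j + 2)
    rw [Finset.sum_range_succ, Finset.sum_range_succ', Finset.sum_range_succ'] at h
    simp only [Nat.choose_self, Nat.choose_zero_right, zero_add, Nat.choose_one_right,
      add_assoc, one_add_one_eq_two] at h
    omega
  rw [← Finset.sum_mul] at hmid
  rw [Finset.sum_range_succ, Finset.sum_range_succ']
  have e1 : M + 2 * (j + 1) - (j + 1 + 1) * (j + 2 + 1 - (j + 1 + 1)) = M + j := by
    have : j + 2 + 1 - (j + 1 + 1) = 1 := by omega
    rw [this]; omega
  have e2 : M + 2 * (j + 1) - (0 + 1) * (j + 2 + 1 - (0 + 1)) = M + j := by omega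
  rw [e1, e2]
  simp only [zero_add, Nat.choose_one_right, Nat.choose_self, add_assoc, one_add_one_eq_two,
    Nat.reduceAdd]
  set Q := ∑ k ∈ Finset.range j, (j + 2).choose (k + 2)
  have hQ : 2 * Q ≤ (j + 3) * 2 ^ j := by
    rw [pow_add] at hchoose
    obtain rfl | hj : j = 4 ∨ 5 ≤ j := by omega
    · omega
    · nlinarith [Nat.zero_le (2 ^ j)]
  calc _ ≤ 2 ^ (j + 3) * (Q * 2 ^ M + ((j + 2) * 2 ^ (M + j) + 1 * 2 ^ (M + j))) := by
        gcongr
    _ = 4 * 2 ^ j * 2 ^ M * (2 * Q + 2 * ((j + 3) * 2 ^ j)) := by ring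
    _ ≤ 4 * 2 ^ j * 2 ^ M * ((j + 3) * 2 ^ j + 2 * ((j + 3) * 2 ^ j)) := by gcongr
    _ = _ := by ring

/-- For `n ≥ 7`, the number of connected labelled graphs on `n` vertices is at least
`2 ^ (n (n - 1) / 2) * (1 - 3 n 2 ^ (-n))`, stated in the equivalent integral form
`2 ^ n * C n ≥ 2 ^ (n (n - 1) / 2) * (2 ^ n - 3 n)`. -/
theorem connectedLabelledGraphCount_lower_bound (n : ℕ) (hn : 7 ≤ n) :
    2 ^ n * connectedLabelledGraphCount n ≥ 2 ^ (n * (n - 1) / 2) * (2 ^ n - 3 * n) := by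
  obtain ⟨m, rfl⟩ : ∃ m, n = m + 1 := ⟨n - 1, by omega⟩
  rw [← Nat.choose_two_right]
  have hN : 2 * (m - 1) ≤ (m + 1).choose 2 := by
    rw [Nat.choose_two_right, Nat.le_div_iff_mul_le two_pos, Nat.add_sub_cancel]
    have : m - 1 ≤ m := Nat.sub_le m 1
    nlinarith
  have h1 := Nat.mul_le_mul_left (2 ^ (m + 1)) (two_pow_le_connectedLabelledGraphCount_add m)
  have h2 := sum_choose_mul_two_pow_le m _ (by omega) hN
  rw [mul_add] at h1
  rw [ge_iff_le, Nat.mul_sub, Nat.sub_le_iff_le_add]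
  linarith
end

section
/- Let n ≥ 2 and let x, y, z be natural numbers with x ≥ z ≥ 1, y ≥ z and x + y − z ≤ n. Then q2(x, y, z) · (x−z)! · z! · (n−x−y+z)! · (y−z)! = (n−2)! · (x·y − z). Equivalently, q2(x,y,z) = (n−2)!(xy − z) / ((x−z)! z! (n−x−y+z)! (y−z)!). -/
/-- The vertex `n - 1` of `Fin n` (for `n ≠ 0`). -/
def lastVtx (n : ℕ) [NeZero n] : Fin n :=
  ⟨n - 1, Nat.sub_lt (Nat.pos_of_ne_zero (NeZero.ne n)) Nat.one_pos⟩

/-- `q1 n x y z` is the number of pairs `(A, B)` of subsets of `Fin n` with `#A = x`,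
`#B = y`, `#(A ∩ B) = z`, such that both distinguished vertices `0` and `n - 1` belong
to `A`. -/
noncomputable def q1 (n : ℕ) [NeZero n] (x y z : ℕ) : ℕ :=
  Nat.card {AB : Finset (Fin n) × Finset (Fin n) //
    AB.1.card = x ∧ AB.2.card = y ∧ (AB.1 ∩ AB.2).card = z ∧
    (0 : Fin n) ∈ AB.1 ∧ lastVtx n ∈ AB.1}

/-- `q2 n x y z` is the number of pairs `(A, B)` of subsets of `Fin n` with `#A = x`,
`#B = y`, `#(A ∩ B) = z`, such that the distinguished vertex `0` belongs to `A` and the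
distinguished vertex `n - 1` belongs to `B`. -/
noncomputable def q2 (n : ℕ) [NeZero n] (x y z : ℕ) : ℕ :=
  Nat.card {AB : Finset (Fin n) × Finset (Fin n) //
    AB.1.card = x ∧ AB.2.card = y ∧ (AB.1 ∩ AB.2).card = z ∧
    (0 : Fin n) ∈ AB.1 ∧ lastVtx n ∈ AB.2}

section SubsetPairs

open Finset

variable {V : Type*} [Fintype V] [DecidableEq V]

/-- The pairs `(A, B)` of finite sets with `#A = x`, `#B = y`, `#(A ∩ B) = z`. -/
def subsetPairs (V : Type*) [Fintype V] [DecidableEq V] (x y z : ℕ) :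
    Finset (Finset V × Finset V) :=
  {AB | #AB.1 = x ∧ #AB.2 = y ∧ #(AB.1 ∩ AB.2) = z}

theorem mem_subsetPairs {x y z : ℕ} {AB : Finset V × Finset V} :
    AB ∈ subsetPairs V x y z ↔ #AB.1 = x ∧ #AB.2 = y ∧ #(AB.1 ∩ AB.2) = z := by
  simp [subsetPairs]

theorem card_filter_card_inter (A : Finset V) {y z : ℕ} (hzy : z ≤ y) :
    #{B : Finset V | #B = y ∧ #(A ∩ B) = z} =
      (#A).choose z * (Fintype.card V - #A).choose (y - z) := by
  rw [← card_compl, ← card_powersetCard, ← card_powersetCard, ← card_product]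
  refine card_nbij' (fun B => (A ∩ B, B \ A)) (fun P => P.1 ∪ P.2) ?_ ?_ ?_ ?_
  · intro B hB
    simp only [coe_filter, mem_univ, true_and, Set.mem_ofPred_eq] at hB
    have h := card_sdiff_add_card_inter B A
    rw [inter_comm B A] at h
    simp only [coe_product, Set.mem_prod, mem_coe, mem_powersetCard]
    refine ⟨⟨inter_subset_left, hB.2⟩, ?_, by omega⟩
    intro a ha
    simp_all
  · rintro ⟨P, Q⟩ h
    simp only [coe_product, Set.mem_prod, mem_coe, mem_powersetCard] at h
    obtain ⟨⟨hP, hPc⟩, hQ, hQc⟩ := h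
    have hAQ : Disjoint A Q := (subset_compl_iff_disjoint_left.mp hQ)
    simp only [coe_filter, mem_univ, true_and, Set.mem_ofPred_eq]
    rw [card_union_of_disjoint (hAQ.mono_left hP), inter_union_distrib_left,
      inter_eq_right.mpr hP, disjoint_iff_inter_eq_empty.mp hAQ, union_empty]
    omega
  · intro B _
    ext a
    simp only [mem_union, mem_inter, mem_sdiff]
    tauto
  · rintro ⟨P, Q⟩ h
    simp only [coe_product, Set.mem_prod, mem_coe, mem_powersetCard] at h
    obtain ⟨⟨hP, -⟩, hQ, -⟩ := h
    have hQ' : ∀ a ∈ Q, a ∉ A := fun a ha => mem_compl.mp (hQ ha)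
    ext a
    · simp only [mem_inter, mem_union]
      grind
    · simp only [mem_sdiff, mem_union]
      grind

theorem card_subsetPairs (x : ℕ) {y z : ℕ} (hzy : z ≤ y) :
    #(subsetPairs V x y z) =
      (Fintype.card V).choose x * (x.choose z * (Fintype.card V - x).choose (y - z)) := by
  have h := card_eq_sum_card_fiberwise (s := subsetPairs V x y z) (f := Prod.fst)
    (t := powersetCard x univ) (fun AB hAB => by
      simpa [mem_powersetCard] using (mem_subsetPairs.mp hAB).1)
  rw [h, ← card_univ (α := V), ← card_powersetCard x univ, ← smul_eq_mul, ← sum_const]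
  refine sum_congr rfl fun A hA => ?_
  obtain ⟨-, rfl⟩ := mem_powersetCard.mp hA
  rw [card_univ, ← card_filter_card_inter A hzy]
  refine card_nbij' Prod.snd (fun B => (A, B)) ?_ ?_ ?_ ?_
  · rintro ⟨A', B⟩ h
    simp only [coe_filter, mem_subsetPairs, Set.mem_ofPred_eq] at h
    obtain ⟨h, rfl⟩ := h
    simpa using h.2
  · intro B h
    simpa [mem_subsetPairs] using h
  · rintro ⟨A', B⟩ h
    simp only [coe_filter, Set.mem_ofPred_eq] at h
    simp [h.2]
  · intro B _
    rfl

theorem card_subsetPairs_mul_factorials {x y z : ℕ} (hzx : z ≤ x) (hzy : z ≤ y)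
    (h : x + y - z ≤ Fintype.card V) :
    #(subsetPairs V x y z) * (x - z).factorial * z.factorial *
      (Fintype.card V - (x + y - z)).factorial * (y - z).factorial =
        (Fintype.card V).factorial := by
  rw [card_subsetPairs x hzy]
  have h1 := Nat.choose_mul_factorial_mul_factorial (n := Fintype.card V) (k := x) (by omega)
  have h2 := Nat.choose_mul_factorial_mul_factorial hzx
  have h3 := Nat.choose_mul_factorial_mul_factorial
    (n := Fintype.card V - x) (k := y - z) (by omega)
  rw [show Fintype.card V - x - (y - z) = Fintype.card V - (x + y - z) by omega] at h3
  rw [← h1, ← h2, ← h3]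
  ring

/-- The number of `(A, B)` in `subsetPairs` with `u ∈ A`, `v ∈ B` is invariant under
permutations. -/
theorem card_filter_subsetPairs_perm (σ : Equiv.Perm V) (x y z : ℕ) (u v : V) :
    #{AB ∈ subsetPairs V x y z | σ u ∈ AB.1 ∧ σ v ∈ AB.2} =
      #{AB ∈ subsetPairs V x y z | u ∈ AB.1 ∧ v ∈ AB.2} := by
  symm
  refine card_equiv ((Equiv.finsetCongr σ).prodCongr (Equiv.finsetCongr σ)) ?_
  rintro ⟨A, B⟩
  simp [mem_subsetPairs, ← map_inter]

theorem exists_perm_apply_eq {V : Type*} [DecidableEq V] {a b u v : V} (hab : a ≠ b) (huv : u ≠ v) :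
    ∃ σ : Equiv.Perm V, σ a = u ∧ σ b = v := by
  refine ⟨Equiv.swap (Equiv.swap a u b) v * Equiv.swap a u, ?_, by simp⟩
  have : u ≠ Equiv.swap a u b := fun h => hab <| (Equiv.swap a u).injective <| by
    rw [Equiv.swap_apply_left]; exact h
  simp [Equiv.swap_apply_of_ne_of_ne this huv]

theorem card_offDiag_filter {x y z : ℕ} {AB : Finset V × Finset V}
    (h : AB ∈ subsetPairs V x y z) :
    #{p ∈ (univ : Finset V).offDiag | p.1 ∈ AB.1 ∧ p.2 ∈ AB.2} = x * y - z := by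
  obtain ⟨rfl, rfl, rfl⟩ := mem_subsetPairs.mp h
  have hd : ({p ∈ (univ : Finset V).offDiag | p.1 ∈ AB.1 ∧ p.2 ∈ AB.2} : Finset (V × V)) =
      (AB.1 ×ˢ AB.2) \ (AB.1 ∩ AB.2).diag := by
    ext ⟨u, v⟩
    simp only [mem_filter, mem_offDiag, mem_univ, true_and, mem_sdiff, mem_product, mem_diag,
      mem_inter]
    grind
  rw [hd, card_sdiff_of_subset, card_product, diag_card]
  rintro ⟨u, v⟩
  simp only [mem_product, mem_diag, mem_inter]
  grind

/-- Double counting of the triples formed by a pair `(A, B)` in `subsetPairs`, a vertex of `A`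
and a different vertex of `B`. -/
theorem card_filter_subsetPairs_mul (x y z : ℕ) {a b : V} (hab : a ≠ b) :
    Fintype.card V * (Fintype.card V - 1) *
        #{AB ∈ subsetPairs V x y z | a ∈ AB.1 ∧ b ∈ AB.2} =
      #(subsetPairs V x y z) * (x * y - z) := by
  have h := sum_card_bipartiteAbove_eq_sum_card_bipartiteBelow
    (s := (univ : Finset V).offDiag) (t := subsetPairs V x y z)
    (fun p AB => p.1 ∈ AB.1 ∧ p.2 ∈ AB.2)
  simp only [bipartiteAbove, bipartiteBelow] at h
  rw [sum_congr rfl (g := fun _ => #{AB ∈ subsetPairs V x y z | a ∈ AB.1 ∧ b ∈ AB.2}),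
    sum_congr rfl (fun AB hAB => card_offDiag_filter hAB)] at h
  · simpa [offDiag_card, Nat.mul_sub] using h
  · rintro ⟨u, v⟩ hp
    obtain ⟨σ, rfl, rfl⟩ := exists_perm_apply_eq hab (mem_offDiag.mp hp).2.2
    exact card_filter_subsetPairs_perm σ x y z a b

end SubsetPairs

theorem q2_eq_card_filter (n x y z : ℕ) [NeZero n] :
    q2 n x y z =
      (Finset.filter (fun AB => 0 ∈ AB.1 ∧ lastVtx n ∈ AB.2)
        (subsetPairs (Fin n) x y z)).card := by
  rw [q2, Nat.card_eq_fintype_card, Fintype.card_subtype]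
  congr 1
  ext AB
  simp [mem_subsetPairs, and_assoc]

/-- Exact value of q2 (Lemma 3 of the paper), in multiplied-out form. -/
theorem q2_value (n x y z : ℕ) [NeZero n] (hn : 2 ≤ n) (hz1 : 1 ≤ z) (hzx : z ≤ x)
    (hzy : z ≤ y) (hxyz : x + y - z ≤ n) :
    q2 n x y z * (x - z).factorial * z.factorial * (n - (x + y - z)).factorial *
      (y - z).factorial = (n - 2).factorial * (x * y - z) := by
  have hne : (0 : Fin n) ≠ lastVtx n := by
    intro h
    have := congrArg Fin.val h
    simp only [Fin.val_zero, lastVtx] at this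
    omega
  have hcount := card_filter_subsetPairs_mul x y z hne
  have hfact := card_subsetPairs_mul_factorials (V := Fin n) hzx hzy (by simpa using hxyz)
  rw [← q2_eq_card_filter] at hcount
  simp only [Fintype.card_fin] at hcount hfact
  obtain ⟨m, rfl⟩ := Nat.exists_eq_add_of_le' hn
  have hm : (m + 2).factorial = (m + 2) * (m + 2 - 1) * m.factorial := by
    simp [Nat.factorial_succ, mul_assoc]
  refine Nat.eq_of_mul_eq_mul_left (show 0 < (m + 2) * (m + 2 - 1) by simp) ?_
  rw [Nat.add_sub_cancel, ← mul_assoc _ m.factorial, ← hm, ← hfact]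
  linear_combination ((x - z).factorial * z.factorial * (m + 2 - (x + y - z)).factorial *
      (y - z).factorial) * hcount
end

section
/- Let n ≥ 2 and let x, y, z be natural numbers with x ≥ z ≥ 1, y ≥ z and x + y − z ≤ n. Then, as integers, (q1(x,y,z) − q2(x,y,z)) · (x−z)! · z! · (n−x−y+z)! · (y−z)! = (n−2)! · (x² − x − x·y + z). -/
open Finset in
theorem exists_perm_apply_eq_pair {α : Type*} [DecidableEq α] {i j k l : α} (hij : i ≠ j)
    (hkl : k ≠ l) : ∃ σ : Equiv.Perm α, σ i = k ∧ σ j = l := by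
  refine ⟨(Equiv.swap i k).trans (Equiv.swap (Equiv.swap i k j) l), ?_, by simp⟩
  have h : k ≠ Equiv.swap i k j := fun h => hij <| by
    have := congrArg (Equiv.swap i k) h
    simpa using this
  simp [Equiv.swap_apply_of_ne_of_ne h hkl]

open Finset in
theorem card_offDiag_filter_mem {α : Type*} [Fintype α] [DecidableEq α] (A B : Finset α) :
    (#{p ∈ (univ : Finset α).offDiag | p.1 ∈ A ∧ p.2 ∈ B} : ℤ) = #A * #B - #(A ∩ B) := by
  have h1 : {p ∈ (univ : Finset α).offDiag | p.1 ∈ A ∧ p.2 ∈ B} =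
      {p ∈ A ×ˢ B | ¬ p.1 = p.2} := by
    ext p; simp; tauto
  have h2 : #{p ∈ A ×ˢ B | p.1 = p.2} = #(A ∩ B) := by
    rw [← diag_card (A ∩ B)]
    congr 1
    ext ⟨a, b⟩
    simp only [mem_filter, mem_product, mem_diag, mem_inter]
    constructor
    · rintro ⟨⟨ha, hb⟩, rfl⟩; exact ⟨⟨ha, hb⟩, rfl⟩
    · rintro ⟨⟨ha, hb⟩, rfl⟩; exact ⟨⟨ha, hb⟩, rfl⟩
  have h3 := card_filter_add_card_filter_not (s := A ×ˢ B) (fun p => p.1 = p.2)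
  rw [h1, ← h2, ← Nat.cast_mul, ← card_product, ← h3]
  push_cast
  ring

/-- Pairs of subsets with prescribed cardinalities of both sets and of their intersection. -/
def pairsWithCard (α : Type*) [Fintype α] [DecidableEq α] (x y z : ℕ) :
    Finset (Finset α × Finset α) :=
  {P | P.1.card = x ∧ P.2.card = y ∧ (P.1 ∩ P.2).card = z}

open Finset in
/-- Double counting over all ordered pairs of distinct points, which are equivalent under the
symmetric group. -/
theorem card_filter_mem_mem_mul {α : Type*} [Fintype α] [DecidableEq α] (x y z : ℕ) (m : ℤ)
    (g : Finset α × Finset α → Finset α)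
    (hg : ∀ (σ : Equiv.Perm α) P, g (P.1.map σ.toEmbedding, P.2.map σ.toEmbedding) =
      (g P).map σ.toEmbedding)
    (hm : ∀ P ∈ pairsWithCard α x y z, (#P.1 * #(g P) - #(P.1 ∩ g P) : ℤ) = m)
    {i j : α} (hij : i ≠ j) :
    (#{P ∈ pairsWithCard α x y z | i ∈ P.1 ∧ j ∈ g P} : ℤ) *
      (Fintype.card α * (Fintype.card α - 1)) = #(pairsWithCard α x y z) * m := by
  have key : ∀ p ∈ (univ : Finset α).offDiag,
      #{P ∈ pairsWithCard α x y z | p.1 ∈ P.1 ∧ p.2 ∈ g P} =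
        #{P ∈ pairsWithCard α x y z | i ∈ P.1 ∧ j ∈ g P} := by
    rintro ⟨k, l⟩ hkl
    obtain ⟨σ, rfl, rfl⟩ := exists_perm_apply_eq_pair hij (by simpa using hkl : k ≠ l)
    symm
    refine card_equiv (Equiv.prodCongr (Equiv.finsetCongr σ) (Equiv.finsetCongr σ)) ?_
    intro P
    have hgP : g (Prod.map (Equiv.finsetCongr σ) (Equiv.finsetCongr σ) P) =
        (g P).map σ.toEmbedding := hg σ P
    simp [pairsWithCard, hgP, ← map_inter]
  have dc := sum_card_bipartiteAbove_eq_sum_card_bipartiteBelow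
    (s := (univ : Finset α).offDiag) (t := pairsWithCard α x y z)
    (fun p P => p.1 ∈ P.1 ∧ p.2 ∈ g P)
  unfold bipartiteAbove bipartiteBelow at dc
  rw [sum_congr rfl key, sum_const, offDiag_card, smul_eq_mul] at dc
  have dc' := congrArg (Nat.cast : ℕ → ℤ) dc
  rw [Nat.cast_sum, sum_congr rfl (fun P hP => (card_offDiag_filter_mem P.1 (g P)).trans (hm P hP)),
    sum_const, nsmul_eq_mul, Nat.cast_mul, Nat.cast_sub (Nat.le_mul_self _)] at dc'
  rw [← dc', card_univ]
  push_cast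
  ring

open Finset in
theorem card_filter_card_inter_eq {α : Type*} [Fintype α] [DecidableEq α] (A : Finset α)
    {y z : ℕ} (hzy : z ≤ y) :
    #{B : Finset α | #B = y ∧ #(A ∩ B) = z} =
      (#A).choose z * (Fintype.card α - #A).choose (y - z) := by
  rw [← card_compl, ← card_powersetCard, ← card_powersetCard, ← card_product]
  refine card_bij' (fun B _ => (A ∩ B, Aᶜ ∩ B)) (fun Q _ => Q.1 ∪ Q.2) ?_ ?_ ?_ ?_
  · intro B hB
    simp only [mem_filter, mem_univ, true_and] at hB
    have h := card_inter_add_card_sdiff B A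
    rw [inter_comm, sdiff_eq_inter_compl, inter_comm B] at h
    simp only [mem_product, mem_powersetCard, inter_subset_left, true_and]
    omega
  · rintro ⟨C, D⟩ h
    simp only [mem_product, mem_powersetCard] at h
    obtain ⟨⟨hC, hc⟩, hD, hd⟩ := h
    have hAD : Disjoint A D := (disjoint_compl_right (a := A)).mono_right hD
    simp only [mem_filter, mem_univ, true_and]
    rw [card_union_of_disjoint (hAD.mono_left hC), inter_union_distrib_left,
      disjoint_iff_inter_eq_empty.mp hAD, inter_eq_right.mpr hC, union_empty]
    omega
  · intro B _
    ext a; simp; tauto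
  · rintro ⟨C, D⟩ h
    simp only [mem_product, mem_powersetCard] at h
    obtain ⟨⟨hC, -⟩, hD, -⟩ := h
    ext a
    · have := @hC a; have := @hD a; simp at *; tauto
    · have := @hC a; have := @hD a; simp at *; tauto

open Finset in
theorem card_pairsWithCard {α : Type*} [Fintype α] [DecidableEq α] (x : ℕ) {y z : ℕ}
    (hzy : z ≤ y) :
    #(pairsWithCard α x y z) = (Fintype.card α).choose x *
      (x.choose z * (Fintype.card α - x).choose (y - z)) := by
  have hmaps : ∀ P ∈ pairsWithCard α x y z, P.1 ∈ powersetCard x (univ : Finset α) := by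
    intro P hP
    simp only [pairsWithCard, mem_filter] at hP
    simpa using hP.2.1
  rw [card_eq_sum_card_fiberwise hmaps, sum_congr rfl (g := fun _ =>
    x.choose z * (Fintype.card α - x).choose (y - z)), sum_const, card_powersetCard, card_univ,
    smul_eq_mul]
  intro A hA
  obtain rfl : #A = x := by simpa using hA
  rw [← card_filter_card_inter_eq A hzy]
  refine card_bij' (fun P _ => P.2) (fun B _ => (A, B)) ?_ ?_ ?_ ?_
  · rintro ⟨A', B⟩ h
    simp only [pairsWithCard, mem_filter, mem_univ, true_and] at h ⊢
    obtain ⟨⟨-, h1, h2⟩, rfl⟩ := h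
    exact ⟨h1, h2⟩
  · intro B h
    simpa [pairsWithCard] using h
  · rintro ⟨A', B⟩ h
    simp only [mem_filter] at h
    rw [h.2]
  · intros; rfl

open Finset in
theorem card_pairsWithCard_mul_factorials {α : Type*} [Fintype α] [DecidableEq α] {x y z : ℕ}
    (hzx : z ≤ x) (hzy : z ≤ y) (h : x + y - z ≤ Fintype.card α) :
    #(pairsWithCard α x y z) * ((x - z).factorial * z.factorial *
      (Fintype.card α - (x + y - z)).factorial * (y - z).factorial) =
      (Fintype.card α).factorial := by
  rw [card_pairsWithCard x hzy]
  have h1 := Nat.choose_mul_factorial_mul_factorial (show x ≤ Fintype.card α by omega)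
  have h2 := Nat.choose_mul_factorial_mul_factorial hzx
  have h3 := Nat.choose_mul_factorial_mul_factorial
    (show y - z ≤ Fintype.card α - x by omega)
  rw [show Fintype.card α - x - (y - z) = Fintype.card α - (x + y - z) by omega] at h3
  rw [← h1, ← h2, ← h3]
  ring

/-- Exact value of q1 - q2, as integers. -/
theorem q1_sub_q2_value (n x y z : ℕ) [NeZero n] (hn : 2 ≤ n) (hz1 : 1 ≤ z) (hzx : z ≤ x)
    (hzy : z ≤ y) (hxyz : x + y - z ≤ n) :
    ((q1 n x y z : ℤ) - (q2 n x y z : ℤ)) * (x - z).factorial * z.factorial *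
      (n - (x + y - z)).factorial * (y - z).factorial =
    (n - 2).factorial * ((x : ℤ) ^ 2 - (x : ℤ) - (x : ℤ) * (y : ℤ) + (z : ℤ)) := by
  have hne : (0 : Fin n) ≠ lastVtx n := by
    intro h
    have := congrArg Fin.val h
    simp only [lastVtx, Fin.val_zero] at this
    omega
  have e1 : q1 n x y z = (Finset.filter (fun P => (0 : Fin n) ∈ P.1 ∧ lastVtx n ∈ P.1)
      (pairsWithCard (Fin n) x y z)).card := by
    rw [q1, Nat.card_eq_fintype_card, Fintype.card_subtype, pairsWithCard, Finset.filter_filter]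
    simp only [and_assoc]
  have e2 : q2 n x y z = (Finset.filter (fun P => (0 : Fin n) ∈ P.1 ∧ lastVtx n ∈ P.2)
      (pairsWithCard (Fin n) x y z)).card := by
    rw [q2, Nat.card_eq_fintype_card, Fintype.card_subtype, pairsWithCard, Finset.filter_filter]
    simp only [and_assoc]
  have c1 := card_filter_mem_mem_mul x y z ((x : ℤ) * x - x) Prod.fst (fun _ _ => rfl)
    (by
      intro P hP
      simp only [pairsWithCard, Finset.mem_filter] at hP
      rw [Finset.inter_self, hP.2.1]) hne
  have c2 := card_filter_mem_mem_mul x y z ((x : ℤ) * y - z) Prod.snd (fun _ _ => rfl)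
    (by
      intro P hP
      simp only [pairsWithCard, Finset.mem_filter] at hP
      rw [hP.2.1, hP.2.2.1, hP.2.2.2]) hne
  have hN := card_pairsWithCard_mul_factorials (α := Fin n) hzx hzy (by simpa using hxyz)
  rw [← e1] at c1
  rw [← e2] at c2
  rw [Fintype.card_fin] at c1 c2 hN
  have hfac : (n.factorial : ℤ) = n * (n - 1) * (n - 2).factorial := by
    obtain ⟨k, rfl⟩ := Nat.exists_eq_add_of_le' hn
    simp only [Nat.add_sub_cancel, Nat.factorial_succ]
    push_cast
    ring
  have hpos : (n : ℤ) * (n - 1) ≠ 0 := by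
    have : (2 : ℤ) ≤ n := by exact_mod_cast hn
    exact mul_ne_zero (by omega) (by omega)
  have hN' := congrArg (Nat.cast : ℕ → ℤ) hN
  rw [hfac] at hN'
  push_cast at hN'
  apply mul_left_cancel₀ hpos
  linear_combination ((x - z).factorial * z.factorial * (n - (x + y - z)).factorial *
    (y - z).factorial : ℤ) * (c1 - c2) + ((x : ℤ) ^ 2 - x - x * y + z) * hN'
end

section
/- Let n ≥ 2 and let k, z be natural numbers with k ≥ z ≥ 1 and 2k − z ≤ n. Then the sum over i from 0 to k − z of q(k+i, k−i, z) equals 0, where q(x,y,z) = q1(x,y,z) − q2(x,y,z) + q1(y,x,z) − q2(y,x,z) when x ≠ y, and q(x,x,z) = q1(x,x,z) − q2(x,x,z). -/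
/-- `q n x y z = q1 - q2 + q1(y,x,z) - q2(y,x,z)` when `x ≠ y`, and `q1 - q2` when `x = y`. -/
noncomputable def q (n : ℕ) [NeZero n] (x y z : ℕ) : ℤ :=
  if x = y then (q1 n x x z : ℤ) - (q2 n x x z : ℤ)
  else (q1 n x y z : ℤ) - (q2 n x y z : ℤ) + (q1 n y x z : ℤ) - (q2 n y x z : ℤ)

/-- Exchange the membership of the vertex `v` between the two sets of a pair. -/
def exchangeAt {α : Type*} [Fintype α] [DecidableEq α] (v : α) (P : Finset α × Finset α) :
    Finset α × Finset α :=
  (Finset.univ.filter fun x => if x = v then x ∈ P.2 else x ∈ P.1,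
    Finset.univ.filter fun x => if x = v then x ∈ P.1 else x ∈ P.2)

section exchangeAt

variable {α : Type*} [Fintype α] [DecidableEq α] (v : α) (P : Finset α × Finset α)

lemma mem_exchangeAt_fst (x : α) :
    x ∈ (exchangeAt v P).1 ↔ if x = v then x ∈ P.2 else x ∈ P.1 := by
  simp [exchangeAt]

lemma mem_exchangeAt_snd (x : α) :
    x ∈ (exchangeAt v P).2 ↔ if x = v then x ∈ P.1 else x ∈ P.2 := by
  simp [exchangeAt]

lemma exchangeAt_exchangeAt : exchangeAt v (exchangeAt v P) = P := by
  ext x <;> simp only [mem_exchangeAt_fst, mem_exchangeAt_snd] <;> split_ifs <;> rfl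

lemma exchangeAt_inter : (exchangeAt v P).1 ∩ (exchangeAt v P).2 = P.1 ∩ P.2 := by
  ext x
  simp only [Finset.mem_inter, mem_exchangeAt_fst, mem_exchangeAt_snd]
  split_ifs <;> tauto

lemma exchangeAt_union : (exchangeAt v P).1 ∪ (exchangeAt v P).2 = P.1 ∪ P.2 := by
  ext x
  simp only [Finset.mem_union, mem_exchangeAt_fst, mem_exchangeAt_snd]
  split_ifs <;> tauto

lemma card_exchangeAt_add_card :
    (exchangeAt v P).1.card + (exchangeAt v P).2.card = P.1.card + P.2.card := by
  rw [← Finset.card_union_add_card_inter, exchangeAt_union, exchangeAt_inter,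
    Finset.card_union_add_card_inter]

end exchangeAt

/-- The contribution of a pair `(A, B)` to `q1 - q2`. -/
def pairSign (n : ℕ) [NeZero n] (P : Finset (Fin n) × Finset (Fin n)) : ℤ :=
  (if 0 ∈ P.1 ∧ lastVtx n ∈ P.1 then 1 else 0) - (if 0 ∈ P.1 ∧ lastVtx n ∈ P.2 then 1 else 0)

lemma zero_ne_lastVtx {n : ℕ} [NeZero n] (hn : 2 ≤ n) : (0 : Fin n) ≠ lastVtx n := by
  intro h
  have := congrArg Fin.val h
  simp only [lastVtx, Fin.val_zero] at this
  omega

lemma pairSign_exchangeAt {n : ℕ} [NeZero n] (hn : 2 ≤ n) (P : Finset (Fin n) × Finset (Fin n)) :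
    pairSign n (exchangeAt (lastVtx n) P) = -pairSign n P := by
  simp [pairSign, mem_exchangeAt_fst, mem_exchangeAt_snd, zero_ne_lastVtx hn]

lemma q1_sub_q2_eq_sum (n : ℕ) [NeZero n] (x y z : ℕ) :
    (q1 n x y z : ℤ) - q2 n x y z =
      ∑ P : Finset (Fin n) × Finset (Fin n) with (P.1 ∩ P.2).card = z,
        if P.1.card = x ∧ P.2.card = y then pairSign n P else 0 := by
  classical
  rw [q1, q2, Nat.card_eq_fintype_card, Nat.card_eq_fintype_card, Fintype.card_subtype,
    Fintype.card_subtype, Finset.natCast_card_filter, Finset.natCast_card_filter,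
    ← Finset.sum_sub_distrib, Finset.sum_filter]
  refine Finset.sum_congr rfl fun P _ => ?_
  unfold pairSign
  split_ifs <;> first | rfl | (exfalso; tauto)

/-- Every pair of sizes `a + b = 2 * k` with `z ≤ a, b` occurs exactly once among the ordered pairs
`(k + i, k - i)` and `(k - i, k + i)` with `i ≤ k - z`. -/
lemma sum_antidiagonal_indicator {k z a b : ℕ} (hzk : z ≤ k) (ha : z ≤ a) (hb : z ≤ b) (c : ℤ) :
    ∑ i ∈ Finset.range (k - z + 1),
      (if k + i = k - i then (if a = k + i ∧ b = k + i then c else 0)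
        else (if a = k + i ∧ b = k - i then c else 0) + (if a = k - i ∧ b = k + i then c else 0)) =
      if a + b = 2 * k then c else 0 := by
  split_ifs with h
  · rw [Finset.sum_eq_single (max a b - k)]
    · split_ifs <;> omega
    · intro i hi hne
      rw [Finset.mem_range] at hi
      split_ifs <;> omega
    · intro hmem
      rw [Finset.mem_range] at hmem
      omega
  · refine Finset.sum_eq_zero fun i hi => ?_
    rw [Finset.mem_range] at hi
    split_ifs <;> omega

/-- Lemma 4 of the paper: the alternating class sizes along an antidiagonal of even total
size sum to zero. -/
theorem sum_q_antidiagonal_even (n k z : ℕ) [NeZero n] (hn : 2 ≤ n) (hz1 : 1 ≤ z)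
    (hzk : z ≤ k) (hkn : 2 * k - z ≤ n) :
    ∑ i ∈ Finset.range (k - z + 1), q n (k + i) (k - i) z = 0 := by
  have hq (i : ℕ) : q n (k + i) (k - i) z =
      ∑ P : Finset (Fin n) × Finset (Fin n) with (P.1 ∩ P.2).card = z,
        (if k + i = k - i then
          (if P.1.card = k + i ∧ P.2.card = k + i then pairSign n P else 0)
        else (if P.1.card = k + i ∧ P.2.card = k - i then pairSign n P else 0) +
          (if P.1.card = k - i ∧ P.2.card = k + i then pairSign n P else 0)) := by
    unfold q
    split_ifs
    · exact q1_sub_q2_eq_sum n _ _ z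
    · rw [Finset.sum_add_distrib, ← q1_sub_q2_eq_sum, ← q1_sub_q2_eq_sum]
      ring
  simp_rw [hq]
  rw [Finset.sum_comm]
  have hP (P : Finset (Fin n) × Finset (Fin n))
      (h : P ∈ ({P | (P.1 ∩ P.2).card = z} : Finset (Finset (Fin n) × Finset (Fin n)))) :=
    have hz : (P.1 ∩ P.2).card = z := (Finset.mem_filter.mp h).2
    sum_antidiagonal_indicator hzk (hz ▸ Finset.card_le_card Finset.inter_subset_left)
      (hz ▸ Finset.card_le_card Finset.inter_subset_right) (pairSign n P)
  rw [Finset.sum_congr rfl hP]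
  have hneg (P : Finset (Fin n) × Finset (Fin n)) :
      (if P.1.card + P.2.card = 2 * k then pairSign n P else 0) +
        (if (exchangeAt (lastVtx n) P).1.card + (exchangeAt (lastVtx n) P).2.card = 2 * k then
          pairSign n (exchangeAt (lastVtx n) P) else 0) = 0 := by
    rw [card_exchangeAt_add_card, pairSign_exchangeAt hn]
    split_ifs <;> simp
  refine Finset.sum_involution (fun P _ => exchangeAt (lastVtx n) P) (fun P _ => hneg P) ?_ ?_
    fun P _ => exchangeAt_exchangeAt _ P
  · intro P _ hne hfix
    have := hneg P
    rw [hfix] at this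
    omega
  · intro P hmem
    simpa [exchangeAt_inter] using hmem
end

section
/- Let n ≥ 2 and let k, z be natural numbers with k ≥ z ≥ 1 and 2k + 1 − z ≤ n. Then the sum over i from 0 to k − z of q(k+i+1, k−i, z) equals 0, where q(x,y,z) = q1(x,y,z) − q2(x,y,z) + q1(y,x,z) − q2(y,x,z) when x ≠ y, and q(x,x,z) = q1(x,x,z) − q2(x,x,z). -/
/-- The set `A` with its membership at `v` replaced by that of `B`. -/
def swapAt {α : Type*} [DecidableEq α] (v : α) (A B : Finset α) : Finset α :=
  if v ∈ B then insert v A else A.erase v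

section SwapAt

variable {α : Type*} [DecidableEq α] (v : α) (A B : Finset α)

theorem mem_swapAt {w : α} : w ∈ swapAt v A B ↔ if w = v then w ∈ B else w ∈ A := by
  unfold swapAt
  split_ifs <;> simp_all

theorem swapAt_inter_swapAt : swapAt v A B ∩ swapAt v B A = A ∩ B := by
  ext w
  simp only [Finset.mem_inter, mem_swapAt]
  split_ifs <;> tauto

theorem swapAt_swapAt : swapAt v (swapAt v A B) (swapAt v B A) = A := by
  ext w
  simp only [mem_swapAt]
  split_ifs <;> tauto

theorem card_swapAt_add_card_swapAt :
    (swapAt v A B).card + (swapAt v B A).card = A.card + B.card := by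
  have hU : swapAt v A B ∪ swapAt v B A = A ∪ B := by
    ext w
    simp only [Finset.mem_union, mem_swapAt]
    split_ifs <;> tauto
  rw [← Finset.card_union_add_card_inter, hU, swapAt_inter_swapAt,
    Finset.card_union_add_card_inter]

end SwapAt

/-- Counting pairs of sets with prescribed intersection size and prescribed odd total size
`2 * k + 1` by the sizes of the two sets. -/
theorem sum_card_pairs_antidiagonal_odd {α : Type*} [Fintype α] [DecidableEq α]
    (P : Finset α × Finset α → Prop) {k z : ℕ} (hzk : z ≤ k) (c : ℕ → ℕ → ℕ)
    (hc : ∀ x y, c x y = Nat.card {AB : Finset α × Finset α //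
      AB.1.card = x ∧ AB.2.card = y ∧ (AB.1 ∩ AB.2).card = z ∧ P AB}) :
    ∑ i ∈ Finset.range (k - z + 1), (c (k + i + 1) (k - i) + c (k - i) (k + i + 1)) =
      Nat.card {AB : Finset α × Finset α //
        AB.1.card + AB.2.card = 2 * k + 1 ∧ (AB.1 ∩ AB.2).card = z ∧ P AB} := by
  classical
  obtain ⟨d, hd⟩ : ∃ d, d = k - z + 1 := ⟨_, rfl⟩
  rw [← hd]
  have hsum : ∑ i ∈ Finset.range d, (c (k + i + 1) (k - i) + c (k - i) (k + i + 1)) =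
      ∑ j ∈ Finset.range (d + d), c (z + j) (2 * k + 1 - (z + j)) := by
    rw [Finset.sum_range_add,
      ← Finset.sum_range_reflect (fun j => c (z + j) (2 * k + 1 - (z + j))) d,
      ← Finset.sum_add_distrib]
    refine Finset.sum_congr rfl fun i hi => ?_
    rw [Finset.mem_range] at hi
    rw [add_comm]
    congr 2 <;> omega
  rw [hsum, Nat.card_eq_fintype_card, Fintype.card_subtype,
    Finset.card_eq_sum_card_fiberwise (f := fun AB => AB.1.card - z) (t := Finset.range (d + d))]
  · refine Finset.sum_congr rfl fun j hj => ?_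
    rw [Finset.mem_range] at hj
    rw [hc, Nat.card_eq_fintype_card, Fintype.card_subtype, Finset.filter_filter]
    congr 1
    refine Finset.filter_congr fun AB _ => ?_
    have hA := Finset.card_le_card (Finset.inter_subset_left : AB.1 ∩ AB.2 ⊆ AB.1)
    constructor
    · rintro ⟨h1, h2, h3, h4⟩
      exact ⟨⟨by omega, h3, h4⟩, by omega⟩
    · rintro ⟨⟨h1, h2, h3⟩, h4⟩
      exact ⟨by omega, by omega, h2, h3⟩
  · intro AB hAB
    simp only [Finset.coe_filter, Finset.mem_univ, true_and, Set.mem_ofPred_eq] at hAB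
    have hB := Finset.card_le_card (Finset.inter_subset_right : AB.1 ∩ AB.2 ⊆ AB.2)
    simp only [Finset.coe_range, Set.mem_Iio]
    omega

/-- Exchanging memberships at `v` matches the pairs with `v ∈ A` with those with `v ∈ B`. -/
theorem card_pairs_mem_mem_eq {α : Type*} [DecidableEq α] {u v : α} (huv : u ≠ v) (s z : ℕ) :
    Nat.card {AB : Finset α × Finset α //
        AB.1.card + AB.2.card = s ∧ (AB.1 ∩ AB.2).card = z ∧ u ∈ AB.1 ∧ v ∈ AB.1} =
      Nat.card {AB : Finset α × Finset α //
        AB.1.card + AB.2.card = s ∧ (AB.1 ∩ AB.2).card = z ∧ u ∈ AB.1 ∧ v ∈ AB.2} := by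
  have hinv : Function.Involutive fun AB : Finset α × Finset α =>
      (swapAt v AB.1 AB.2, swapAt v AB.2 AB.1) :=
    fun _ => Prod.ext (swapAt_swapAt v _ _) (swapAt_swapAt v _ _)
  refine Nat.card_congr (hinv.toPerm.subtypeEquiv fun AB => ?_)
  rw [Function.Involutive.coe_toPerm]
  simp [card_swapAt_add_card_swapAt, swapAt_inter_swapAt, mem_swapAt, huv]

/-- Lemma 5 of the paper: the alternating class sizes along an antidiagonal of odd total
size sum to zero. -/
theorem sum_q_antidiagonal_odd (n k z : ℕ) [NeZero n] (hn : 2 ≤ n) (hz1 : 1 ≤ z)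
    (hzk : z ≤ k) (hkn : 2 * k + 1 - z ≤ n) :
    ∑ i ∈ Finset.range (k - z + 1), q n (k + i + 1) (k - i) z = 0 := by
  have hne : (0 : Fin n) ≠ lastVtx n := by
    simp only [ne_eq, Fin.ext_iff, lastVtx, Fin.val_zero]
    omega
  have h1 := sum_card_pairs_antidiagonal_odd
    (fun AB => (0 : Fin n) ∈ AB.1 ∧ lastVtx n ∈ AB.1) hzk (q1 n · · z) fun _ _ => rfl
  have h2 := sum_card_pairs_antidiagonal_odd
    (fun AB => (0 : Fin n) ∈ AB.1 ∧ lastVtx n ∈ AB.2) hzk (q2 n · · z) fun _ _ => rfl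
  have h := (h1.trans (card_pairs_mem_mem_eq hne _ _)).trans h2.symm
  zify at h
  rw [← sub_eq_zero, ← Finset.sum_sub_distrib] at h
  rw [← h]
  refine Finset.sum_congr rfl fun i _ => ?_
  rw [q, if_neg (by omega)]
  ring
end

section
/- For all natural numbers k, z with k ≥ z, the following identity holds in ℚ: Σ_{i=1}^{k−z} (4i² − 2k + 2z) / ((k+i−z)! · (k−i−z)!) = (k − z) / ((k−z)! · (k−z)!). -/
/-- Partial sums of `(4 i ^ 2 - 2 n) / ((n + i)! (n - i)!)`, by telescoping. -/
theorem sum_Icc_div_factorial_mul_factorial (n m : ℕ) (hm : m ≤ n) :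
    ∑ i ∈ Finset.Icc 1 m,
      (4 * (i : ℚ) ^ 2 - 2 * (n : ℚ)) /
        ((Nat.factorial (n + i) : ℚ) * (Nat.factorial (n - i) : ℚ)) =
    (n : ℚ) / ((Nat.factorial n : ℚ) * (Nat.factorial n : ℚ)) -
      (2 * (m : ℚ) + 1) * ((n : ℚ) - m) /
        ((Nat.factorial (n + m) : ℚ) * (Nat.factorial (n - m) : ℚ)) := by
  induction m with
  | zero => simp
  | succ m ih =>
    obtain ⟨d, rfl⟩ := Nat.exists_eq_add_of_le hm
    rw [Finset.sum_Icc_succ_top (by omega), ih (by omega),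
      show m + 1 + d - m = d + 1 by omega, show m + 1 + d - (m + 1) = d by omega,
      show m + 1 + d + (m + 1) = (m + 1 + d + m) + 1 by omega,
      Nat.factorial_succ (m + 1 + d + m), Nat.factorial_succ d]
    have h₁ : (Nat.factorial (m + 1 + d + m) : ℚ) ≠ 0 := by positivity
    have h₂ : (Nat.factorial d : ℚ) ≠ 0 := by positivity
    have h₃ : (m : ℚ) + 1 + d + m + 1 ≠ 0 := by positivity
    have h₄ : (d : ℚ) + 1 ≠ 0 := by positivity
    rw [sub_add, sub_right_inj]
    push_cast
    field_simp
    ring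

/-- The combinatorial identity underlying Lemma 4 of the paper. -/
theorem sum_identity_even (k z : ℕ) (hzk : z ≤ k) :
    ∑ i ∈ Finset.Icc 1 (k - z),
      (4 * (i : ℚ) ^ 2 - 2 * (k : ℚ) + 2 * (z : ℚ)) /
        ((Nat.factorial (k + i - z) : ℚ) * (Nat.factorial (k - i - z) : ℚ)) =
    ((k - z : ℕ) : ℚ) / ((Nat.factorial (k - z) : ℚ) * (Nat.factorial (k - z) : ℚ)) := by
  have h := sum_Icc_div_factorial_mul_factorial (k - z) (k - z) le_rfl
  rw [sub_self, mul_zero, zero_div, sub_zero] at h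
  rw [← h]
  refine Finset.sum_congr rfl fun i _ => ?_
  rw [show k + i - z = k - z + i by omega, show k - i - z = k - z - i by omega,
    Nat.cast_sub hzk]
  ring
end

section
/- For all natural numbers k, z with k ≥ z, the following identity holds in ℚ: Σ_{i=1}^{k−z} (2i² + 2i − k + z) / ((k+i+1−z)! · (k−i−z)!) = (k − z) / ((k+1−z)! · (k−z)!). -/
theorem sum_Icc_odd_telescope (n m : ℕ) (hm : m ≤ n) :
    ∑ i ∈ Finset.Icc 1 m, (2 * (i : ℚ) ^ 2 + 2 * (i : ℚ) - (n : ℚ)) /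
        ((Nat.factorial (n + i + 1) : ℚ) * (Nat.factorial (n - i) : ℚ)) =
      (n : ℚ) / ((Nat.factorial (n + 1) : ℚ) * (Nat.factorial n : ℚ)) -
        ((m : ℚ) + 1) * ((n : ℚ) - m) /
          ((Nat.factorial (n + m + 1) : ℚ) * (Nat.factorial (n - m) : ℚ)) := by
  induction m with
  | zero => simp
  | succ m ih =>
    obtain ⟨d, rfl⟩ := Nat.exists_eq_add_of_le hm
    rw [Finset.sum_Icc_succ_top (by omega), ih (by omega), sub_add]
    congr 1
    have h₁ : m + 1 + d - m = d + 1 := by omega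
    have h₂ : m + 1 + d - (m + 1) = d := by omega
    have h₃ : m + 1 + d + (m + 1) + 1 = (m + 1 + d + m + 1) + 1 := by omega
    rw [h₁, h₂, h₃, Nat.factorial_succ (m + 1 + d + m + 1), Nat.factorial_succ d]
    have hf := Nat.cast_ne_zero (R := ℚ).mpr (Nat.factorial_ne_zero (m + 1 + d + m + 1))
    have hd := Nat.cast_ne_zero (R := ℚ).mpr (Nat.factorial_ne_zero d)
    have hs : ((m : ℚ) + 1 + d + m + 1 + 1) ≠ 0 := by positivity
    have ht : ((d : ℚ) + 1) ≠ 0 := by positivity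
    push_cast
    field_simp
    ring

/-- The combinatorial identity underlying Lemma 5 of the paper. -/
theorem sum_identity_odd (k z : ℕ) (hzk : z ≤ k) :
    ∑ i ∈ Finset.Icc 1 (k - z),
      (2 * (i : ℚ) ^ 2 + 2 * (i : ℚ) - (k : ℚ) + (z : ℚ)) /
        ((Nat.factorial (k + i + 1 - z) : ℚ) * (Nat.factorial (k - i - z) : ℚ)) =
    ((k - z : ℕ) : ℚ) / ((Nat.factorial (k + 1 - z) : ℚ) * (Nat.factorial (k - z) : ℚ)) := by
  obtain ⟨n, rfl⟩ := Nat.exists_eq_add_of_le hzk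
  have h := sum_Icc_odd_telescope n n le_rfl
  rw [sub_self, mul_zero, zero_div, sub_zero] at h
  have h₁ : z + n - z = n := by omega
  have h₂ : z + n + 1 - z = n + 1 := by omega
  rw [h₁, h₂, ← h]
  refine Finset.sum_congr rfl fun i _ => ?_
  have h₃ : z + n + i + 1 - z = n + i + 1 := by omega
  have h₄ : z + n - i - z = n - i := by omega
  rw [h₃, h₄]
  push_cast
  ring
end
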